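/- arXiv:2305.08402 — 3 statements merged into one kernel-verified Lean document; each statement's English description precedes it below -/
import Mathlib

section
/- Let p ≥ 8 be an integer divisible by 4. Then (1+X²)² divides Q_p(X) in ℤ[X], and the quotient Q_p(X)/(1+X²)² has no repeated complex roots and is divisible by none of X+1, X-1, and X²+1. -/
open Polynomial

/-- The polynomial `Q_p(X) = 1 - X^(p-4) + X^(p-2) + 2X^p + X^(p+2) - X^(p+4) + X^(2p)` in `ℤ[X]`
(for `p ≥ 5`). -/
noncomputable def Qp (p : ℕ) : Polynomial ℤ :=
  1 - X ^ (p - 4) + X ^ (p - 2) + 2 * X ^ p + X ^ (p + 2) - X ^ (p + 4) + X ^ (2 * p)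

/-- The cofactor of `(1 + X²)²` in `Qp (4 * j + 4)`. -/
noncomputable def qpCofactor (j : ℕ) : ℤ[X] :=
  ((X ^ 2 - 1) * ∑ i ∈ Finset.range (j + 1), (X ^ 4) ^ i) ^ 2 - X ^ (4 * j) * (X ^ 4 - 3 * X ^ 2 + 1)

theorem Qp_eq (j : ℕ) : Qp (4 * j + 4) = 1 - X ^ (4 * j) + X ^ (4 * j + 2) + 2 * X ^ (4 * j + 4)
    + X ^ (4 * j + 6) - X ^ (4 * j + 8) + X ^ (8 * j + 8) := by
  have h1 : 4 * j + 4 - 4 = 4 * j := by omega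
  have h2 : 4 * j + 4 - 2 = 4 * j + 2 := by omega
  rw [Qp, h1, h2]
  ring

theorem Qp_eq_mul_qpCofactor (j : ℕ) :
    Qp (4 * j + 4) = (1 + X ^ 2) ^ 2 * qpCofactor j := by
  have hg := geom_sum_mul (X ^ 4 : ℤ[X]) (j + 1)
  have hpow : (X ^ 4 : ℤ[X]) ^ (j + 1) = X ^ (4 * j) * X ^ 4 := by ring
  rw [hpow] at hg
  rw [Qp_eq, qpCofactor]
  generalize (∑ i ∈ Finset.range (j + 1), (X ^ 4 : ℤ[X]) ^ i) = S at hg ⊢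
  have h8 : (X : ℤ[X]) ^ (8 * j + 8) = (X ^ (4 * j)) ^ 2 * X ^ 8 := by ring
  rw [h8]
  simp only [pow_add]
  generalize (X : ℤ[X]) ^ (4 * j) = T at hg ⊢
  linear_combination (-(S * (X ^ 4 - 1)) - (T * X ^ 4 - 1)) * hg

theorem Qp_monic (j : ℕ) (hj : 1 ≤ j) : (Qp (4 * j + 4)).Monic := by
  rw [Qp_eq, add_comm]
  refine monic_X_pow_add (n := 8 * j + 8) ?_
  refine lt_of_le_of_lt (b := ((4 * j + 8 : ℕ) : WithBot ℕ)) ?_ (by norm_cast; omega)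
  rw [← natDegree_le_iff_degree_le]
  compute_degree

theorem isIntegral_of_aeval_Qp_eq_zero {j : ℕ} (hj : 1 ≤ j) {a : ℂ}
    (h : aeval a (Qp (4 * j + 4)) = 0) : IsIntegral ℤ a :=
  ⟨_, Qp_monic j hj, h⟩

theorem aeval_Qp_inv_eq_zero {j : ℕ} {a : ℂ} (ha : a ≠ 0)
    (h : aeval a (Qp (4 * j + 4)) = 0) : aeval a⁻¹ (Qp (4 * j + 4)) = 0 := by
  have h8 (b : ℂ) : b ^ (8 * j + 8) = (b ^ (4 * j)) ^ 2 * b ^ 8 := by ring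
  have hsymm : aeval a (Qp (4 * j + 4)) = (a ^ (4 * j)) ^ 2 * a ^ 8 *
      aeval a⁻¹ (Qp (4 * j + 4)) := by
    simp only [Qp_eq, map_add, map_sub, map_mul, map_pow, aeval_X, map_one, map_ofNat, h8]
    simp only [pow_add]
    rw [inv_pow a (4 * j)]
    have hT0 : a ^ (4 * j) ≠ 0 := pow_ne_zero _ ha
    generalize a ^ (4 * j) = T at hT0 ⊢
    field_simp
    ring
  rw [h] at hsymm
  exact (mul_eq_zero.mp hsymm.symm).resolve_left (by positivity)

/-- A quarter is not an algebraic integer. -/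
theorem not_isIntegral_quarter : ¬ IsIntegral ℤ (1 / 4 : ℂ) := by
  intro h
  have h' : IsIntegral ℤ (1 / 4 : ℚ) := by
    rw [← isIntegral_algebraMap_iff (algebraMap ℚ ℂ).injective]
    simpa using h
  obtain ⟨n, hn⟩ := IsIntegrallyClosed.isIntegral_iff.mp h'
  have : (4 * n : ℚ) = 1 := by
    simp only [eq_intCast] at hn
    rw [hn]; norm_num
  have : 4 * n = 1 := by exact_mod_cast this
  omega

theorem sq_eq_neg_one_of_double_root_Qp {j : ℕ} (hj : 1 ≤ j) {a : ℂ}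
    (h : aeval a (Qp (4 * j + 4)) = 0) (h' : aeval a (derivative (Qp (4 * j + 4))) = 0) :
    a ^ 2 = -1 := by
  have ha : a ≠ 0 := by
    rintro rfl
    have : j ≠ 0 := by omega
    simp [Qp_eq, this] at h
  have hint := isIntegral_of_aeval_Qp_eq_zero hj h
  have hint' := isIntegral_of_aeval_Qp_eq_zero hj (aeval_Qp_inv_eq_zero ha h)
  have hd : aeval a (X * derivative (Qp (4 * j + 4))) = 0 := by rw [map_mul, h', mul_zero]
  have hderiv : X * derivative (Qp (4 * j + 4)) = -(4 * (j : ℤ[X])) * X ^ (4 * j)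
      + (4 * (j : ℤ[X]) + 2) * X ^ (4 * j + 2) + 2 * (4 * (j : ℤ[X]) + 4) * X ^ (4 * j + 4)
      + (4 * (j : ℤ[X]) + 6) * X ^ (4 * j + 6) - (4 * (j : ℤ[X]) + 8) * X ^ (4 * j + 8)
      + (8 * (j : ℤ[X]) + 8) * X ^ (8 * j + 8) := by
    have hX (n : ℕ) : X * derivative (X ^ n : ℤ[X]) = (n : ℤ[X]) * X ^ n := by
      rcases n with _ | n
      · simp
      · simp only [derivative_X_pow, map_natCast, Nat.add_sub_cancel]; ring
    have h2 : derivative (2 * X ^ (4 * j + 4) : ℤ[X]) = 2 * derivative (X ^ (4 * j + 4)) := by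
      simp [derivative_mul]
    rw [Qp_eq]
    simp only [derivative_add, derivative_sub, h2, derivative_one, mul_add, mul_sub]
    rw [mul_left_comm X 2]
    simp only [hX]
    push_cast
    ring
  rw [hderiv] at hd
  rw [Qp_eq] at h
  have h8 : a ^ (8 * j + 8) = (a ^ (4 * j)) ^ 2 * a ^ 8 := by ring
  simp only [map_add, map_sub, map_mul, map_neg, map_pow, aeval_X, map_one, map_ofNat,
    map_natCast, h8] at h hd
  have hT0 : a ^ (4 * j) ≠ 0 := pow_ne_zero _ ha
  have hT1 : a ^ 2 = 1 → a ^ (4 * j) = 1 := fun e ↦ by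
    rw [show 4 * j = 2 * (2 * j) by ring, pow_mul, e, one_pow]
  simp only [pow_add] at h hd
  generalize a ^ (4 * j) = T at *
  obtain ⟨y, hy⟩ : ∃ y, y = a ^ 2 := ⟨_, rfl⟩
  have hy0 : y ≠ 0 := hy ▸ pow_ne_zero _ ha
  have hyi : IsIntegral ℤ y := hy ▸ hint.pow 2
  have hvi : IsIntegral ℤ y⁻¹ := by rw [hy, ← inv_pow]; exact hint'.pow 2
  rw [← hy] at hT1 ⊢
  have e4 : a ^ 4 = y ^ 2 := by rw [hy]; ring
  have e6 : a ^ 6 = y ^ 3 := by rw [hy]; ring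
  have e8 : a ^ 8 = y ^ 4 := by rw [hy]; ring
  rw [e4, e6, e8, ← hy] at h hd
  obtain ⟨B, hB⟩ : ∃ B, B = y ^ 4 - y ^ 3 - 2 * y ^ 2 - y + 1 := ⟨_, rfl⟩
  obtain ⟨C, hC⟩ : ∃ C, C = 2 * (y ^ 2 - 1) * (2 * y ^ 2 - y + 2) := ⟨_, rfl⟩
  have hQ : T ^ 2 * y ^ 4 + 1 = T * B := by rw [hB]; linear_combination h
  have hQ' : 2 * (4 * j + 4) * (T * y ^ 4) = (4 * j + 4) * B + C := by
    apply mul_left_cancel₀ hT0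
    rw [hB, hC]
    linear_combination hd
  have hres : C ^ 2 = (4 * j + 4) ^ 2 * (B ^ 2 - 4 * y ^ 4) := by
    linear_combination (-(2 * (4 * j + 4) * (T * y ^ 4)) + (4 * j + 4) * B - C) * hQ' +
      4 * (4 * j + 4) ^ 2 * y ^ 4 * hQ
  have hfac : (y ^ 2 - 1) ^ 2 * ((2 * y ^ 2 - y + 2) ^ 2
      - 4 * (j + 1) ^ 2 * ((y ^ 2 + y + 1) * (y ^ 2 - 3 * y + 1))) = 0 := by
    rw [hB, hC] at hres
    linear_combination hres / 4
  rcases mul_eq_zero.mp hfac with h1 | h1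
  · have h2 : (y - 1) * (y + 1) = 0 := by
      linear_combination pow_eq_zero_iff two_ne_zero |>.mp h1
    rcases mul_eq_zero.mp h2 with h3 | h3
    · have hy1 : y = 1 := by linear_combination h3
      rw [hT1 hy1, hy1] at h
      norm_num at h
    · linear_combination h3
  · exfalso
    apply not_isIntegral_quarter
    have hu : (1 / 4 : ℂ) = ((j + 1 : ℕ) : ℂ) ^ 2 * ((y + y⁻¹ + (1 : ℕ)) * (y + y⁻¹ - (3 : ℕ)))
        - (y + y⁻¹) ^ 2 + (y + y⁻¹) := by
      push_cast
      field_simp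
      linear_combination h1
    have hn (n : ℕ) : IsIntegral ℤ (n : ℂ) := isIntegral_algebraMap (x := (n : ℤ))
    have hs := hyi.add hvi
    rw [hu]
    exact ((((hn _).pow 2).mul ((hs.add (hn 1)).mul (hs.sub (hn 3)))).sub (hs.pow 2)).add hs

theorem aeval_qpCofactor_ne_zero {j : ℕ} {a : ℂ} (ha : a ^ 2 = -1) :
    aeval a (qpCofactor j) ≠ 0 := by
  have e4 : a ^ 4 = 1 := by rw [show 4 = 2 * 2 by rfl, pow_mul, ha]; norm_num
  intro h
  simp [qpCofactor, pow_mul, e4, ha, map_ofNat (aeval a) 3] at h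
  have : (4 * (j + 1) ^ 2 : ℂ) = 5 := by linear_combination h
  have : 4 * (j + 1) ^ 2 = 5 := by exact_mod_cast this
  omega

/-- for `p ≥ 8` divisible by `4`, `(1+X²)²` divides `Q_p` in `ℤ[X]`, and the quotient
has no repeated complex roots and is divisible by none of `X+1`, `X-1`, `X²+1`. -/
theorem stmt5 (p : ℕ) (hp : 8 ≤ p) (hp4 : 4 ∣ p) :
    ∃ q : Polynomial ℤ, Qp p = (1 + X ^ 2) ^ 2 * q ∧
      (∀ a : ℂ, (q.map (Int.castRingHom ℂ)).rootMultiplicity a ≤ 1) ∧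
      ¬ (X + 1 ∣ q) ∧ ¬ (X - 1 ∣ q) ∧ ¬ (X ^ 2 + 1 ∣ q) := by
  obtain ⟨j, rfl⟩ : ∃ j, p = 4 * j + 4 := ⟨p / 4 - 1, by omega⟩
  refine ⟨qpCofactor j, Qp_eq_mul_qpCofactor j, fun a ↦ ?_, ?_, ?_, ?_⟩
  · by_contra! hlt
    have hne : (qpCofactor j).map (Int.castRingHom ℂ) ≠ 0 := fun h0 ↦ by simp [h0] at hlt
    obtain ⟨h, h'⟩ := (one_lt_rootMultiplicity_iff_isRoot hne).mp hlt
    rw [derivative_map] at h'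
    rw [IsRoot.def, eval_map, ← algebraMap_int_eq, ← aeval_def] at h h'
    refine aeval_qpCofactor_ne_zero (sq_eq_neg_one_of_double_root_Qp (j := j) (by omega) ?_ ?_) h
    · rw [Qp_eq_mul_qpCofactor, map_mul, h, mul_zero]
    · rw [Qp_eq_mul_qpCofactor, derivative_mul, map_add, map_mul, map_mul, h, h', mul_zero,
        mul_zero, add_zero]
  · rintro ⟨r, hr⟩
    have := congrArg (eval (-1)) hr
    simp [qpCofactor, pow_mul] at this
  · rintro ⟨r, hr⟩
    have := congrArg (eval 1) hr
    simp [qpCofactor] at this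
  · rintro ⟨r, hr⟩
    refine aeval_qpCofactor_ne_zero (j := j) Complex.I_sq ?_
    simp [hr]
end

section
/- Let p ≥ 6 be an integer with p ≡ 2 (mod 4). Then the polynomial Q_p(X) has no repeated complex roots. -/
open Polynomial

theorem Qp_monic_s6 {p : ℕ} (hp : 5 ≤ p) : (Qp p).Monic := by
  have h : (1 - X ^ (p - 4) + X ^ (p - 2) + 2 * X ^ p + X ^ (p + 2) - X ^ (p + 4) :
      ℤ[X]).natDegree ≤ p + 4 := by
    compute_degree
  rw [Qp, add_comm]
  refine monic_X_pow_add (lt_of_le_of_lt degree_le_natDegree ?_)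
  exact_mod_cast (by omega : _ < 2 * p)

theorem aeval_Qp {p : ℕ} (hp : 4 ≤ p) {a : ℂ} (ha : a ≠ 0) :
    aeval a (Qp p) = a ^ p *
      (a ^ p + (a⁻¹) ^ p + 2 + (a ^ 2 + a⁻¹ ^ 2) - (a ^ 4 + a⁻¹ ^ 4)) := by
  obtain ⟨n, rfl⟩ := Nat.exists_eq_add_of_le' hp
  simp only [Qp, map_add, map_sub, map_mul, map_pow, aeval_X, map_one, map_ofNat, inv_pow,
    Nat.add_sub_cancel, show n + 4 - 2 = n + 2 by omega]
  field_simp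
  ring

theorem mul_aeval_derivative_Qp {p : ℕ} (hp : 5 ≤ p) {a : ℂ} (ha : a ≠ 0) :
    a * aeval a (derivative (Qp p)) = p * aeval a (Qp p) + a ^ p *
      (p * (a ^ p - (a⁻¹) ^ p) + 2 * (a ^ 2 - a⁻¹ ^ 2) - 4 * (a ^ 4 - a⁻¹ ^ 4)) := by
  obtain ⟨n, rfl⟩ := Nat.exists_eq_add_of_le' hp
  simp only [Qp, derivative_mul, derivative_X_pow, derivative_one,
    derivative_ofNat, map_add, map_sub, map_mul, map_pow, aeval_X, map_one, map_ofNat, map_zero,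
    map_natCast, show n + 5 - 4 = n + 1 by omega, show n + 5 - 2 = n + 3 by omega,
    show 2 * (n + 5) - 1 = 2 * n + 9 by omega, Nat.add_sub_cancel,
    show n + 3 - 1 = n + 2 by omega, show n + 5 - 1 = n + 4 by omega,
    show n + 5 + 2 - 1 = n + 6 by omega, show n + 5 + 4 - 1 = n + 8 by omega, inv_pow]
  push_cast
  field_simp
  ring

theorem isIntegral_of_aeval_Qp {p : ℕ} (hp : 5 ≤ p) {a : ℂ} (h : aeval a (Qp p) = 0) :
    IsIntegral ℤ a :=
  ⟨Qp p, Qp_monic_s6 hp, h⟩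

/-- An algebraic integer that is a root of `u X² + v X + w` is a rational integer,
or else `u` divides `v`. -/
theorem IsIntegral.exists_int_or_dvd_of_quadratic {t : ℂ} (ht : IsIntegral ℤ t) {u v w : ℤ}
    (hu : u ≠ 0) (h : u * t ^ 2 + v * t + w = 0) :
    (∃ n : ℤ, u * n ^ 2 + v * n + w = 0) ∨ u ∣ v := by
  set F : ℤ[X] := C u * X ^ 2 + C v * X + C w with hF
  have hdeg : F.natDegree = 2 := natDegree_quadratic hu
  have hroot : aeval t F = 0 := by simpa [hF] using h
  obtain ⟨N, hN⟩ := minpoly.isIntegrallyClosed_dvd ht hroot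
  have hM := minpoly.monic ht
  have hpos := minpoly.natDegree_pos ht
  have hN0 : N ≠ 0 := by
    rintro rfl
    rw [hN] at hdeg
    simp at hdeg
  have hsum : (minpoly ℤ t).natDegree + N.natDegree = 2 := by
    rw [← hdeg, hN, hM.natDegree_mul' hN0]
  obtain h1 | h2 : (minpoly ℤ t).natDegree = 1 ∨ N.natDegree = 0 := by omega
  · left
    refine ⟨-(minpoly ℤ t).coeff 0, ?_⟩
    have hev : (F.eval (-(minpoly ℤ t).coeff 0)) = 0 := by
      rw [hN, eval_mul, hM.eq_X_add_C h1]
      simp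
    simpa [hF] using hev
  · right
    rw [natDegree_eq_zero] at h2
    obtain ⟨c, rfl⟩ := h2
    have h2' : (minpoly ℤ t).coeff 2 = 1 := by
      have : (minpoly ℤ t).natDegree = 2 := by simpa using hsum
      rw [← this]
      exact hM
    have c2 : u = c := by
      have := congrArg (fun q => coeff q 2) hN
      simpa [hF, coeff_mul_C, h2', coeff_X, coeff_C, -eq_intCast] using this
    have c1 : v = (minpoly ℤ t).coeff 1 * c := by
      have := congrArg (fun q => coeff q 1) hN
      simpa [hF, coeff_mul_C, coeff_X, coeff_C, -eq_intCast] using this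
    exact ⟨_, by rw [c1, c2, mul_comm]⟩

theorem not_isIntegral_of_quadratic {k : ℤ} (hk : 1 ≤ k) {t : ℂ} (ht : IsIntegral ℤ t)
    (h : (2 * k + 1 : ℂ) ^ 2 * ((t - 3) * (t + 1)) = (2 * t - 1) ^ 2) : False := by
  have hA : (2 * k + 1) ^ 2 - 4 ≠ 0 := by nlinarith
  obtain ⟨n, hn⟩ | hdvd := ht.exists_int_or_dvd_of_quadratic hA
    (v := 4 - 2 * (2 * k + 1) ^ 2) (w := -(3 * (2 * k + 1) ^ 2 + 1))
    (by push_cast; linear_combination h)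
  · obtain ⟨r, hr | hr⟩ := Int.even_or_odd' n
    · obtain ⟨j, hj⟩ := Int.even_mul_succ_self k
      obtain ⟨i, hi⟩ := Int.even_mul_succ_self r
      subst hr
      have : 2 * ((8 * j - 3) * i + r * (2 - 8 * j) - 3 * j) = 1 := by
        have h4 : 4 * (2 * ((8 * j - 3) * i + r * (2 - 8 * j) - 3 * j)) = 4 * 1 := by
          linear_combination hn - (16 * r ^ 2 - 16 * r - 12) * hj - 4 * (8 * j - 3) * hi
        omega
      omega
    · subst hr
      ring_nf at hn
      omega
  · have h4 : (2 * k + 1) ^ 2 - 4 ∣ 4 := by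
      have := (hdvd.add (dvd_mul_left ((2 * k + 1) ^ 2 - 4) 2))
      ring_nf at this ⊢
      simpa using (dvd_neg.mpr this)
    have := Int.le_of_dvd (by norm_num) h4
    nlinarith

/-- for `p ≥ 6` with `p ≡ 2 (mod 4)`, `Q_p` has no repeated complex roots. -/
theorem stmt6 (p : ℕ) (hp : 6 ≤ p) (hpmod : p % 4 = 2) :
    ∀ a : ℂ, ((Qp p).map (Int.castRingHom ℂ)).rootMultiplicity a ≤ 1 := by
  intro a
  by_contra! hlt
  have hne : (Qp p).map (Int.castRingHom ℂ) ≠ 0 := ((Qp_monic_s6 (by omega)).map _).ne_zero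
  obtain ⟨h0, h1⟩ := (one_lt_rootMultiplicity_iff_isRoot hne).mp hlt
  rw [derivative_map, IsRoot, ← algebraMap_int_eq, eval_map_algebraMap] at h1
  rw [IsRoot, ← algebraMap_int_eq, eval_map_algebraMap] at h0
  have ha : a ≠ 0 := by
    rintro rfl
    simp [Qp, show p - 4 ≠ 0 by omega, show p - 2 ≠ 0 by omega, show p ≠ 0 by omega] at h0
  have hE := pow_ne_zero p ha
  have hval := h0
  rw [aeval_Qp (by omega) ha] at hval
  have hinv : aeval a⁻¹ (Qp p) = 0 := by
    rw [aeval_Qp (by omega) (inv_ne_zero ha), inv_inv]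
    have := (mul_eq_zero.mp hval).resolve_left hE
    linear_combination (a⁻¹) ^ p * this
  have hder := mul_aeval_derivative_Qp (by omega : 5 ≤ p) ha
  rw [h0, h1, mul_zero, mul_zero, zero_add, eq_comm] at hder
  replace hval := (mul_eq_zero.mp hval).resolve_left hE
  replace hder := (mul_eq_zero.mp hder).resolve_left hE
  have hint : IsIntegral ℤ (a ^ 2 + a⁻¹ ^ 2) :=
    ((isIntegral_of_aeval_Qp (by omega) h0).pow 2).add
      ((isIntegral_of_aeval_Qp (by omega) hinv).pow 2)
  obtain ⟨k, rfl⟩ : ∃ k, p = 2 * (2 * k + 1) := ⟨p / 4, by omega⟩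
  have hab : a * a⁻¹ = 1 := mul_inv_cancel₀ ha
  generalize a⁻¹ = b at *
  rw [pow_mul a, pow_mul b] at hval hder
  have hcd : a ^ 2 * b ^ 2 = 1 := by rw [← mul_pow, hab, one_pow]
  rw [show a ^ 4 = (a ^ 2) ^ 2 by ring, show b ^ 4 = (b ^ 2) ^ 2 by ring] at hval hder
  generalize a ^ 2 = y at *
  generalize b ^ 2 = z at *
  have hEF : y ^ (2 * k + 1) * z ^ (2 * k + 1) = 1 := by rw [← mul_pow, hcd, one_pow]
  have hy : y ^ (2 * k + 1) = y * (y ^ 2) ^ k := by ring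
  have hz : z ^ (2 * k + 1) = z * (z ^ 2) ^ k := by ring
  push_cast at hder
  generalize y ^ (2 * k + 1) = E at *
  generalize z ^ (2 * k + 1) = F at *
  have hsum : E + F = (y + z) ^ 2 - (y + z) - 4 := by
    linear_combination hval - 2 * hcd
  have hdiff : (2 * k + 1 : ℂ) * (E - F) = (y - z) * (2 * (y + z) - 1) := by
    linear_combination hder / 2
  have hmain : ((y + z) - 2) * (((y + z) + 2) * ((2 * k + 1 : ℂ) ^ 2 *
      (((y + z) - 3) * ((y + z) + 1)) - (2 * (y + z) - 1) ^ 2)) = 0 := by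
    linear_combination (-(2 * k + 1 : ℂ) ^ 2 * (E + F + ((y + z) ^ 2 - (y + z) - 4))) * hsum
      + ((2 * k + 1 : ℂ) * (E - F) + (y - z) * (2 * (y + z) - 1)) * hdiff
      + 4 * (2 * k + 1 : ℂ) ^ 2 * hEF - 4 * (2 * (y + z) - 1) ^ 2 * hcd
  have hdouble (h : (y + z) ^ 2 = 4) : E + F = y + z := by
    have hyz : y = z := by
      have : (y - z) ^ 2 = 0 := by linear_combination h - 4 * hcd
      exact sub_eq_zero.mp (pow_eq_zero_iff two_ne_zero |>.mp this)
    subst hyz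
    have hy1 : y ^ 2 = 1 := by rw [sq, hcd]
    rw [hy1, one_pow, mul_one] at hy hz
    rw [hy, hz]
  obtain h | h := mul_eq_zero.mp hmain
  · have : (4 : ℂ) = 0 := by
      linear_combination hsum - hdouble (by linear_combination (y + z + 2) * h)
        + ((y + z) * h)
    norm_num at this
  obtain h | h := mul_eq_zero.mp h
  · have : (4 : ℂ) = 0 := by
      linear_combination hdouble (by linear_combination (y + z - 2) * h) - hsum
        - (y + z - 4) * h
    norm_num at this
  · have hk : (1 : ℤ) ≤ k := by omega
    exact not_isIntegral_of_quadratic hk hint (by push_cast; linear_combination h)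
end

section
/- Let m ≥ 4 be an even integer, set p = 2m, and let n ≥ 2 be an integer. Then the sum ∑_{a} (8·τ_{2m}(a))^n, taken over the set of distinct complex roots a of Q_{2m} different from √-1 and -√-1, is an integer (i.e., it equals z for some z ∈ ℤ). -/
open Polynomial

/-- The set of distinct complex roots of `Q_p`. -/
noncomputable def QpRoots (p : ℕ) : Finset ℂ :=
  ((Qp p).map (Int.castRingHom ℂ)).roots.toFinset

/-- The adjoint Reidemeister torsion `τ_p(a)` of `S³_{p/1}(4₁)` at the representation
parametrized by `a` (for `a ∉ {1, -1, √-1, -√-1}`). -/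
noncomputable def tau (p : ℕ) (a : ℂ) : ℂ :=
  -((4 - (p : ℂ) + ((p : ℂ) - 2) * a ^ 2 + 2 * (p : ℂ) * a ^ 4 + ((p : ℂ) + 2) * a ^ 6 -
      ((p : ℂ) + 4) * a ^ 8 + 2 * (p : ℂ) * a ^ (p + 4)) /
    (2 * (a ^ 2 - 1) ^ 3 * (1 + a ^ 2)))

/-- The sum of an integer polynomial over the distinct complex roots of a monic integer polynomial
is an integer. -/
theorem exists_int_eq_sum_aeval_roots {f : ℤ[X]} (hf : f.Monic) (P : ℤ[X]) :
    ∃ z : ℤ, ∑ a ∈ (f.map (Int.castRingHom ℂ)).roots.toFinset, aeval a P = (z : ℂ) := by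
  classical
  obtain ⟨g, hg⟩ : ∃ g : ℚ[X], g = f.map (Int.castRingHom ℚ) := ⟨_, rfl⟩
  have hg0 : g ≠ 0 := hg ▸ (hf.map _).ne_zero
  obtain ⟨K, _, _, _⟩ : ∃ (K : Type) (_ : Field K) (_ : Algebra ℚ K), IsSplittingField ℚ K g :=
    ⟨g.SplittingField, _, _, IsSplittingField.splittingField g⟩
  have : IsGalois ℚ K := by
    have : Normal ℚ K := Normal.of_isSplittingField g
    constructor
  have : FiniteDimensional ℚ K := IsSplittingField.finiteDimensional K g
  let φ : K →ₐ[ℚ] ℂ := IsAlgClosed.lift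
  set T : Finset K := (g.map (algebraMap ℚ K)).roots.toFinset with hT
  have hmemT (a : K) : a ∈ T ↔ aeval a g = 0 := by
    rw [hT, Multiset.mem_toFinset, mem_roots_map hg0, aeval_def]
  have hroots : (f.map (Int.castRingHom ℂ)).roots.toFinset = T.image φ := by
    have hmap : f.map (Int.castRingHom ℂ) = (g.map (algebraMap ℚ K)).map (φ : K →+* ℂ) := by
      rw [hg, Polynomial.map_map, Polynomial.map_map]
      congr 1
      exact Subsingleton.elim _ _
    rw [hmap, (IsSplittingField.splits K g).roots_map, Multiset.toFinset_map]
    rfl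
  have hsum : ∑ a ∈ (f.map (Int.castRingHom ℂ)).roots.toFinset, aeval a P
      = φ (∑ a ∈ T, aeval a P) := by
    have hφ : Function.Injective φ := φ.toRingHom.injective
    rw [hroots, Finset.sum_image hφ.injOn, map_sum]
    refine Finset.sum_congr rfl fun a _ => ?_
    exact aeval_algHom_apply (φ.restrictScalars ℤ) a P
  have hfixed : ∑ a ∈ T, aeval a P ∈ (⊥ : IntermediateField ℚ K) := by
    rw [IsGalois.mem_bot_iff_fixed]
    intro σ
    rw [map_sum]
    refine Finset.sum_bij (fun a _ => σ a) (fun a ha => ?_) (fun a _ b _ h => σ.injective h)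
      (fun b hb => ⟨σ.symm b, ?_, by simp⟩) fun a _ => ?_
    · rw [hmemT] at ha ⊢
      rw [aeval_algHom_apply σ, ha, map_zero]
    · rw [hmemT] at hb ⊢
      rw [aeval_algHom_apply σ.symm, hb, map_zero]
    · exact (aeval_algHom_apply ((σ : K →ₐ[ℚ] K).restrictScalars ℤ) a P).symm
  have hint : IsIntegral ℤ (∑ a ∈ T, aeval a P) := by
    refine IsIntegral.sum _ fun a ha => ?_
    have ha' : IsIntegral ℤ a := by
      refine ⟨f, hf, ?_⟩
      rw [hmemT, hg, aeval_def, eval₂_map] at ha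
      rwa [Subsingleton.elim (algebraMap ℤ K) ((algebraMap ℚ K).comp (Int.castRingHom ℚ))]
    exact .of_mem_of_fg _ ha'.fg_adjoin_singleton _ (aeval_mem_adjoin_singleton ℤ a)
  obtain ⟨q, hq⟩ := IntermediateField.mem_bot.mp hfixed
  rw [← hq, isIntegral_algebraMap_iff (algebraMap ℚ K).injective] at hint
  obtain ⟨z, hz⟩ := IsIntegrallyClosed.isIntegral_iff.mp hint
  refine ⟨z, ?_⟩
  rw [hsum, ← hq, ← hz]
  simp

theorem monic_Qp {p : ℕ} (hp : 4 < p) : (Qp p).Monic := by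
  have h : Qp p = X ^ (2 * p) +
      (1 - X ^ (p - 4) + X ^ (p - 2) + 2 * X ^ p + X ^ (p + 2) - X ^ (p + 4)) := by
    rw [Qp]; ring
  rw [h]
  refine monic_X_pow_add (lt_of_le_of_lt (b := ((p + 4 : ℕ) : WithBot ℕ)) ?_ (by norm_cast; lia))
  refine degree_le_of_natDegree_le ?_
  compute_degree

theorem exists_aeval_eq_eight_tau {m : ℕ} (hm : 4 ≤ m) (heven : Even m) :
    ∃ P : ℤ[X], ∀ a : ℂ, aeval a (Qp (2 * m)) = 0 → 1 + a ^ 2 ≠ 0 →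
      aeval a P = 8 * tau (2 * m) a := by
  obtain ⟨k, rfl⟩ : ∃ k, m = 2 * k + 4 := by
    obtain ⟨j, rfl⟩ := heven
    exact ⟨j - 2, by lia⟩
  let q : ℤ[X] := 1 - X ^ (2 * k + 2) + X ^ (2 * k + 3) + 2 * X ^ (2 * k + 4) + X ^ (2 * k + 5)
    - X ^ (2 * k + 6) + X ^ (2 * (2 * k) + 8)
  let N : ℤ[X] := 4 - C (4 * (k : ℤ) + 8) + C (4 * (k : ℤ) + 6) * X + C (8 * (k : ℤ) + 16) * X ^ 2
    + C (4 * (k : ℤ) + 10) * X ^ 3 - C (4 * (k : ℤ) + 12) * X ^ 4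
    + C (8 * (k : ℤ) + 16) * X ^ (2 * k + 6)
  obtain ⟨q₁, hq₁⟩ : X - C (-1) ∣ q := by
    rw [dvd_iff_isRoot]
    simp [q, pow_add, pow_mul]
  obtain ⟨r, hr⟩ : X - C (-1) ∣ q₁ := by
    rw [dvd_iff_isRoot]
    have h := congrArg (eval (-1) ∘ derivative) hq₁
    simp [q] at h
    simp [pow_add, pow_mul] at h
    rw [IsRoot, ← h]
    ring
  obtain ⟨s, hs⟩ : X - C 1 ∣ r - 1 := by
    rw [dvd_iff_isRoot]
    have h := congrArg (eval 1) hq₁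
    rw [hr] at h
    simp [q] at h ⊢
    lia
  obtain ⟨M, hM⟩ : X - C (-1) ∣ N := by
    rw [dvd_iff_isRoot]
    simp [N, pow_add, pow_mul]
    ring
  refine ⟨(4 * M * s ^ 3).comp (X ^ 2), fun a ha hne => ?_⟩
  have hqa : aeval (a ^ 2) q = 0 := by
    rw [← ha]
    simp [q, Qp, map_ofNat]
    rw [show 2 * (2 * k + 4) - 4 = 2 * (2 * k + 2) by lia,
      show 2 * (2 * k + 4) - 2 = 2 * (2 * k + 3) by lia]
    ring
  have hra : aeval (a ^ 2) r = 0 := by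
    rw [hq₁, hr] at hqa
    simpa [add_comm, hne] using hqa
  have hsa : (a ^ 2 - 1) * aeval (a ^ 2) s = -1 := by
    have h := congrArg (aeval (a ^ 2)) hs
    simpa [hra, eq_comm] using h
  have hNa : aeval (a ^ 2) N = (1 + a ^ 2) * aeval (a ^ 2) M := by
    simpa [add_comm (1 : ℂ)] using congrArg (aeval (a ^ 2)) hM
  have hsub : a ^ 2 - 1 ≠ 0 := left_ne_zero_of_mul (hsa.trans_ne (by norm_num))
  have hs' : aeval (a ^ 2) s = -(a ^ 2 - 1)⁻¹ := by
    field_simp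
    linear_combination hsa
  have hM' : aeval (a ^ 2) M = aeval (a ^ 2) N / (1 + a ^ 2) := by
    rw [eq_div_iff hne, hNa, mul_comm]
  have htau : tau (2 * (2 * k + 4)) a =
      -(aeval (a ^ 2) N / (2 * (a ^ 2 - 1) ^ 3 * (1 + a ^ 2))) := by
    simp [N, tau, map_ofNat]
    ring
  rw [aeval_comp, htau]
  simp only [map_mul, map_pow, map_ofNat, hs', hM', aeval_X]
  field_simp
  ring

/-- for even `m ≥ 4`, `p = 2m`, and `n ≥ 2`: the sum `∑_a (8τ_{2m}(a))^n`, over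
the distinct complex roots of `Q_{2m}` different from `±√-1`, is an integer. -/
theorem stmt19 (m : ℕ) (hm : 4 ≤ m) (heven : Even m) (n : ℕ) (hn : 2 ≤ n) :
    ∃ z : ℤ, ∑ a ∈ QpRoots (2 * m) \ {Complex.I, -Complex.I},
      (8 * tau (2 * m) a) ^ n = (z : ℂ) := by
  obtain ⟨P, hP⟩ := exists_aeval_eq_eight_tau hm heven
  have hQ : (Qp (2 * m)).Monic := monic_Qp (by lia)
  have hX : (X ^ 2 + 1 : ℤ[X]).Monic := by monicity!
  obtain ⟨z, hz⟩ := exists_int_eq_sum_aeval_roots (hQ.mul hX) (P ^ n)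
  obtain ⟨w, hw⟩ := exists_int_eq_sum_aeval_roots hX (P ^ n)
  have hI (a : ℂ) : 1 + a ^ 2 = 0 ↔ a = Complex.I ∨ a = -Complex.I := by
    rw [← sq_eq_sq_iff_eq_or_eq_neg, Complex.I_sq, add_comm, add_eq_zero_iff_eq_neg]
  have hXroots : ((X ^ 2 + 1 : ℤ[X]).map (Int.castRingHom ℂ)).roots.toFinset =
      {Complex.I, -Complex.I} := by
    ext a
    rw [Multiset.mem_toFinset, mem_roots (hX.map _).ne_zero]
    simp [← hI, add_comm]
  have hroots : ((Qp (2 * m) * (X ^ 2 + 1)).map (Int.castRingHom ℂ)).roots.toFinset =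
      QpRoots (2 * m) ∪ {Complex.I, -Complex.I} := by
    rw [Polynomial.map_mul, roots_mul (mul_ne_zero (hQ.map _).ne_zero (hX.map _).ne_zero),
      Multiset.toFinset_add, hXroots, QpRoots]
  rw [hXroots] at hw
  rw [hroots, ← Finset.sum_sdiff Finset.subset_union_right, hw, Finset.union_sdiff_right] at hz
  refine ⟨z - w, ?_⟩
  rw [Int.cast_sub, ← hz, add_sub_cancel_right]
  refine Finset.sum_congr rfl fun a ha => ?_
  rw [Finset.mem_sdiff, QpRoots, Multiset.mem_toFinset, mem_roots (hQ.map _).ne_zero] at ha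
  rw [map_pow, hP a]
  · rw [aeval_def, ← eval_map]
    exact ha.1
  · rw [ne_eq, hI]
    simpa using ha.2
end
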